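/- arXiv:1511.09378 — 4 statements merged into one kernel-verified Lean document; each statement's English description precedes it below -/
import Mathlib

section
/- Let M be a finite-above inverse monoid and A ⊆ M a subset such that M is generated, under multiplication and inversion, by A together with the set of idempotents of M. Suppose t : A → M assigns to every a ∈ A a maximal element t(a) of M with a ≤ t(a). Then M is generated, under multiplication and inversion, by (t(A) \ {1}) together with the set of idempotents of M; thus t(A) \ {1} is a quasi-generating set of M consisting of maximal elements distinct from 1. -/
namespace FInv

variable {M : Type*}

/-- The natural partial order on an inverse monoid: `a ≤ b` iff `a = e * b`
for some idempotent `e`. -/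
def natLe [Monoid M] (a b : M) : Prop := ∃ e : M, e * e = e ∧ a = e * b

/-- `inv` is an inversion map making the monoid an inverse monoid:
every element has a unique generalized inverse, given by `inv`. -/
def IsInverseMonoid [Monoid M] (inv : M → M) : Prop :=
  (∀ a : M, a * inv a * a = a) ∧ (∀ a : M, inv a * a * inv a = inv a) ∧
    (∀ a b : M, a * b * a = a → b * a * b = b → b = inv a)

/-- `m` is maximal with respect to the natural partial order. -/
def IsMaximal [Monoid M] (m : M) : Prop := ∀ n : M, natLe m n → n = m

/-- `M` is finite-above: the set of elements above any element is finite. -/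
def FiniteAbove (M : Type*) [Monoid M] : Prop := ∀ m : M, {n : M | natLe m n}.Finite

/-- The least group congruence `σ`: `a σ b` iff some element lies below both. -/
def sigmaRel [Monoid M] (a b : M) : Prop := ∃ c : M, natLe c a ∧ natLe c b

/-- `M` is E-unitary: every element above an idempotent is idempotent. -/
def EUnitary (M : Type*) [Monoid M] : Prop :=
  ∀ e a : M, e * e = e → natLe e a → a * a = a

/-- The set of idempotents of `M`. -/
def idems (M : Type*) [Monoid M] : Set M := {e : M | e * e = e}

/-- The submonoid generated by `S` together with the inverses of elements of `S`,
i.e. the closure of `S` under multiplication and inversion. -/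
def invClosure [Monoid M] (inv : M → M) (S : Set M) : Submonoid M :=
  Submonoid.closure (S ∪ inv '' S)

/-- `M` is quasi-generated by `S`: `M` is generated, under multiplication and
inversion, by `S` together with the idempotents of `M`. -/
def QuasiGen [Monoid M] (inv : M → M) (S : Set M) : Prop :=
  invClosure inv (S ∪ idems M) = ⊤

/-- A homomorphism is idempotent-separating if it is injective on idempotents. -/
def IdempotentSeparating [Monoid M] {N : Type*} [Monoid N] (φ : M →* N) : Prop :=
  ∀ e f : M, e * e = e → f * f = f → φ e = φ f → e = f

/-- A dual premorphism from a group `H` to an inverse monoid `M` (with inversion `inv`). -/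
def IsDualPremorphism {H : Type*} [Group H] [Monoid M] (inv : M → M) (ψ : H → M) : Prop :=
  ψ 1 = 1 ∧ (∀ h : H, ψ h⁻¹ = inv (ψ h)) ∧ ∀ g h : H, natLe (ψ g * ψ h) (ψ (g * h))

/-- Property (1): every element of `M` lies below some `ψ h`. -/
def Property1 {H : Type*} [Group H] [Monoid M] (ψ : H → M) : Prop :=
  ∀ m : M, ∃ h : H, natLe m (ψ h)

end FInv

open FInv

theorem idem_comm_aux {M : Type*} [Monoid M] (inv : M → M)
    (hM : IsInverseMonoid inv) (e f : M) (he : e * e = e) (hf : f * f = f) :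
    e * f = f * e := by
  obtain ⟨h1, h2, h3⟩ := hM
  have prodIdem : ∀ e f : M, e * e = e → f * f = f → (e * f) * (e * f) = e * f := by
    intro e f he hf
    have he' : ∀ z, e * (e * z) = e * z := fun z => by rw [← mul_assoc, he]
    have hf' : ∀ z, f * (f * z) = f * z := fun z => by rw [← mul_assoc, hf]
    have a1 := h1 (e * f)
    have a2 := h2 (e * f)
    have a3 := h3 (e * f) (f * inv (e * f) * e)
    generalize inv (e * f) = x at a1 a2 a3
    have a2' : ∀ z, x * (e * (f * (x * z))) = x * z := fun z => by
      have := congrArg (· * z) a2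
      simpa only [mul_assoc] using this
    simp only [mul_assoc] at a1 a2 a3
    have hx : f * (x * e) = x := by
      apply a3
      · simp only [he', hf', a1]
      · simp only [he', hf', a2']
    have hxx : x * x = x := by
      calc x * x = (f * (x * e)) * (f * (x * e)) := by rw [hx]
        _ = f * (x * e) := by simp only [mul_assoc, a2']
        _ = x := hx
    have b1 : x = inv x := h3 x x (by rw [hxx, hxx]) (by rw [hxx, hxx])
    have b2 : e * f = inv x := h3 x (e * f) (by simpa only [mul_assoc] using a2)
      (by simpa only [mul_assoc] using a1)
    rw [b2, ← b1, hxx]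
  have p := prodIdem e f he hf
  have q := prodIdem f e hf he
  have he' : ∀ z, e * (e * z) = e * z := fun z => by rw [← mul_assoc, he]
  have hf' : ∀ z, f * (f * z) = f * z := fun z => by rw [← mul_assoc, hf]
  have c1 : e * f = inv (e * f) := h3 _ _ (by rw [p, p]) (by rw [p, p])
  have c2 : f * e = inv (e * f) := by
    apply h3
    · simp only [mul_assoc] at p ⊢
      simp only [he', hf', p]
    · simp only [mul_assoc] at q ⊢
      simp only [he', hf', q]
  rw [c2, ← c1]

theorem inv_idem_mul_aux {M : Type*} [Monoid M] (inv : M → M)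
    (hM : IsInverseMonoid inv) (e t : M) (he : e * e = e) :
    inv (e * t) = inv t * e := by
  have h1 := hM.1 t
  have h2 := hM.2.1 t
  have hc := idem_comm_aux inv hM e (t * inv t) he (by rw [← mul_assoc, h1])
  symm
  apply hM.2.2
  · calc e * t * (inv t * e) * (e * t) = e * (t * inv t) * (e * e) * t := by
          simp only [mul_assoc]
      _ = (e * e) * (t * inv t * t) := by rw [he, hc, mul_assoc _ e e, he, ← hc, mul_assoc]
      _ = e * t := by rw [he, h1]
  · calc inv t * e * (e * t) * (inv t * e) = inv t * ((e * e) * (t * inv t)) * e := by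
          simp only [mul_assoc]
      _ = (inv t * t * inv t) * (e * e) := by rw [he, hc]; simp only [mul_assoc, he]
      _ = inv t * e := by rw [he, h2]

/-- A quasi-generating set of a finite-above inverse monoid can be replaced by
maximal elements above its members, omitting `1`. -/
theorem stmt2 {M : Type*} [Monoid M] (inv : M → M)
    (hM : IsInverseMonoid inv) (hfa : FiniteAbove M)
    (A : Set M) (hA : QuasiGen inv A)
    (t : M → M) (ht : ∀ a ∈ A, natLe a (t a) ∧ IsMaximal (t a)) :
    QuasiGen inv ((t '' A) \ {1}) := by
  have hid : ∀ e : M, e * e = e → e ∈ invClosure inv (((t '' A) \ {1}) ∪ idems M) :=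
    fun e he => Submonoid.subset_closure (Or.inl (Or.inr he))
  have hidinv : ∀ e : M, e * e = e → inv e = e := fun e he =>
    (hM.2.2 e e (by rw [he, he]) (by rw [he, he])).symm
  have htm : ∀ a ∈ A, t a ∈ invClosure inv (((t '' A) \ {1}) ∪ idems M) ∧
      inv (t a) ∈ invClosure inv (((t '' A) \ {1}) ∪ idems M) := by
    intro a ha
    by_cases h : t a = 1
    · rw [h, hidinv 1 (one_mul 1)]
      exact ⟨Submonoid.one_mem _, Submonoid.one_mem _⟩
    · have hm : t a ∈ ((t '' A) \ {1}) ∪ idems M := Or.inl ⟨⟨a, ha, rfl⟩, h⟩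
      exact ⟨Submonoid.subset_closure (Or.inl hm),
        Submonoid.subset_closure (Or.inr ⟨_, hm, rfl⟩)⟩
  unfold QuasiGen at hA ⊢
  rw [eq_top_iff, ← hA]
  refine Submonoid.closure_le.2 ?_
  rintro x ((hx | hx) | ⟨y, (hy | hy), rfl⟩)
  · obtain ⟨⟨e, he, h⟩, -⟩ := ht x hx
    rw [h]
    exact Submonoid.mul_mem _ (hid e he) (htm x hx).1
  · exact hid x hx
  · obtain ⟨⟨e, he, h⟩, -⟩ := ht y hy
    have : inv y = inv (t y) * e := by
      rw [← inv_idem_mul_aux inv hM e (t y) he, ← h]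
    rw [this]
    exact Submonoid.mul_mem _ (htm y hy).2 (hid e he)
  · rw [hidinv y hy]
    exact hid y hy
end

section
/- Let U be an E-unitary inverse monoid, M an inverse monoid, and φ : U → M an idempotent-separating homomorphism. Then for every t ∈ U, the restriction of φ to the set {y ∈ U : t ≤ y} is injective: if t ≤ y, t ≤ y₁ and φ(y) = φ(y₁), then y = y₁. -/
open FInv

/-- In an inverse monoid the product of two idempotents is idempotent. -/
theorem idem_mul_idem {U : Type*} [Monoid U] {inv : U → U} (h : IsInverseMonoid inv)
    {e f : U} (he : e * e = e) (hf : f * f = f) : (e * f) * (e * f) = e * f := by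
  obtain ⟨h1, h2, h3⟩ := h
  have a1 := h1 (e * f)
  have a2 := h2 (e * f)
  have key : f * inv (e * f) * e = inv (e * f) := by
    apply h3
    · calc e * f * (f * inv (e * f) * e) * (e * f)
          = e * (f * f) * inv (e * f) * ((e * e) * f) := by simp only [mul_assoc]
        _ = e * f := by rw [he, hf, a1]
    · calc f * inv (e * f) * e * (e * f) * (f * inv (e * f) * e)
          = f * (inv (e * f) * ((e * e) * (f * f)) * inv (e * f)) * e := by
            simp only [mul_assoc]
        _ = f * inv (e * f) * e := by rw [he, hf, a2]
  have hx : inv (e * f) * inv (e * f) = inv (e * f) := by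
    calc inv (e * f) * inv (e * f)
        = (f * inv (e * f) * e) * (f * inv (e * f) * e) := by rw [key]
      _ = f * (inv (e * f) * (e * f) * inv (e * f)) * e := by simp only [mul_assoc]
      _ = inv (e * f) := by rw [a2, key]
  have b1 : e * f = inv (inv (e * f)) := h3 _ _ a2 a1
  have b2 : inv (e * f) = inv (inv (e * f)) := h3 _ _ (by rw [hx, hx]) (by rw [hx, hx])
  have b3 : e * f = inv (e * f) := b1.trans b2.symm
  rw [← b3] at hx
  exact hx

/-- An idempotent-separating homomorphism from an E-unitary inverse monoid is
injective on principal up-sets of the natural partial order. -/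
theorem stmt4 {M U : Type*} [Monoid M] [Monoid U]
    (invM : M → M) (invU : U → U)
    (hM : IsInverseMonoid invM) (hU : IsInverseMonoid invU)
    (hEU : EUnitary U)
    (φ : U →* M) (hsep : IdempotentSeparating φ) :
    ∀ t y y₁ : U, natLe t y → natLe t y₁ → φ y = φ y₁ → y = y₁ := by
  intro t y z ⟨e, he, hty⟩ ⟨f, hf, htz⟩ hyz
  obtain ⟨h1, h2, h3⟩ := id hU
  have hinv : ∀ a, φ (invU a) = invM (φ a) := fun a =>
    hM.2.2 _ _ (by rw [← map_mul, ← map_mul, h1]) (by rw [← map_mul, ← map_mul, h2])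
  have il : ∀ a, (invU a * a) * (invU a * a) = invU a * a := fun a => by
    rw [← mul_assoc, h2]
  have ir : ∀ a, (a * invU a) * (a * invU a) = a * invU a := fun a => by
    rw [← mul_assoc, h1]
  have hl : invU y * y = invU z * z :=
    hsep _ _ (il y) (il z) (by rw [map_mul, map_mul, hinv, hinv, hyz])
  have hfe : (f * e) * (y * invU z) = f * (z * invU z) := by
    calc (f * e) * (y * invU z) = f * (e * y) * invU z := by simp only [mul_assoc]
      _ = (f * f) * z * invU z := by rw [← hty, htz]; simp only [mul_assoc]
      _ = f * (z * invU z) := by rw [hf, mul_assoc]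
  have ha : (y * invU z) * (y * invU z) = y * invU z :=
    hEU (f * (z * invU z)) _ (idem_mul_idem hU hf (ir z))
      ⟨f * e, idem_mul_idem hU hf he, hfe.symm⟩
  have hb : y * invU z = z * invU z :=
    hsep _ _ ha (ir z) (by rw [map_mul, map_mul, hyz])
  calc y = y * (invU y * y) := by rw [← mul_assoc, h1]
    _ = y * invU z * z := by rw [hl, mul_assoc]
    _ = z := by rw [hb, h1]
end

section
/- Let M be an inverse monoid which is quasi-A-generated with respect to a map ε_M : A → M whose image consists of maximal elements of M. Let F be an F-inverse monoid and φ : F → M a surjective homomorphism. Then for every a ∈ A there exists f ∈ F such that f is the greatest element of its σ-class in F (with respect to the natural partial order of F) and φ(f) = ε_M(a). -/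
open FInv

theorem idem_prod {F : Type*} [Monoid F] (inv : F → F) (h : IsInverseMonoid inv)
    (e f : F) (he : e * e = e) (hf : f * f = f) : (e * f) * (e * f) = e * f := by
  obtain ⟨h1, h2, h3⟩ := h
  have a1 := h1 (e * f)
  have a2 := h2 (e * f)
  have a3 := h3 (e * f)
  have a4 := h3 (inv (e * f))
  generalize inv (e * f) = s at *
  have he' : ∀ x, e * (e * x) = e * x := fun x => by rw [← mul_assoc, he]
  have hf' : ∀ x, f * (f * x) = f * x := fun x => by rw [← mul_assoc, hf]
  have a2' : ∀ x, s * (e * (f * (s * x))) = s * x := fun x => by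
    have := congrArg (· * x) a2
    simpa only [mul_assoc] using this
  have k : f * s * e = s := by
    apply a3
    · simp only [mul_assoc, he', hf'] at a1 ⊢
      exact a1
    · simp only [mul_assoc, he', hf', a2']
  have ks : s * s = s := by
    have : (f * s * e) * (f * s * e) = f * s * e := by
      simp only [mul_assoc, a2']
    rwa [k] at this
  have b1 := a4 s (by rw [ks, ks]) (by rw [ks, ks])
  have b2 := a4 (e * f) a2 a1
  rw [b2, ← b1, ks]

theorem idem_comm {F : Type*} [Monoid F] (inv : F → F) (h : IsInverseMonoid inv)
    (e f : F) (he : e * e = e) (hf : f * f = f) : e * f = f * e := by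
  have p := idem_prod inv h e f he hf
  have q := idem_prod inv h f e hf he
  have he' : ∀ x, e * (e * x) = e * x := fun x => by rw [← mul_assoc, he]
  have hf' : ∀ x, f * (f * x) = f * x := fun x => by rw [← mul_assoc, hf]
  have b1 := h.2.2 (e * f) (e * f) (by rw [p, p]) (by rw [p, p])
  have b2 := h.2.2 (e * f) (f * e)
    (by simp only [mul_assoc, he', hf'] at p ⊢; exact p)
    (by simp only [mul_assoc, he', hf'] at q ⊢; exact q)
  rw [b2, ← b1]

/-- If `M` is quasi-`A`-generated by maximal elements and `φ : F → M` is a surjective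
homomorphism from an F-inverse monoid, then each generator of `M` is the image of
a greatest element of a σ-class of `F`. -/
theorem stmt9 {A F M : Type*} [Monoid F] [Monoid M]
    (invF : F → F) (invM : M → M)
    (hF : IsInverseMonoid invF) (hM : IsInverseMonoid invM)
    (εM : A → M) (hmax : ∀ a : A, IsMaximal (εM a))
    (hgen : QuasiGen invM (Set.range εM))
    (hFinv : ∀ x : F, ∃ m : F, sigmaRel x m ∧ ∀ y : F, sigmaRel x y → natLe y m)
    (φ : F →* M) (hsurj : Function.Surjective φ) :
    ∀ a : A, ∃ f : F, (∀ y : F, sigmaRel f y → natLe y f) ∧ φ f = εM a := by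
  intro a
  obtain ⟨x, hx⟩ := hsurj (εM a)
  obtain ⟨m, -, hm⟩ := hFinv x
  have hxm : natLe x m :=
    hm x ⟨x, ⟨1, one_mul 1, (one_mul x).symm⟩, ⟨1, one_mul 1, (one_mul x).symm⟩⟩
  obtain ⟨e, he, hxe⟩ := hxm
  refine ⟨m, ?_, ?_⟩
  · rintro y ⟨c, ⟨f, hf, hcf⟩, ⟨g, hg, hcg⟩⟩
    refine hm y ⟨f * x, ⟨f, hf, rfl⟩, ⟨e * g, idem_prod invF hF e g he hg, ?_⟩⟩
    rw [hxe, ← mul_assoc, idem_comm invF hF f e hf he, mul_assoc, ← hcf, hcg, mul_assoc]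
  · apply hmax a
    refine ⟨φ e, by rw [← map_mul, he], ?_⟩
    rw [← hx, ← map_mul, ← hxe]
end

section
/- Let M be a finite-above E-unitary inverse monoid. Suppose there exist maximal elements a, b of M with a σ b and an element v ∈ M satisfying condition (C): writing D = {d ∈ M : d σ v and d is maximal in M} and letting h be the least upper bound (with respect to the natural partial order) of the set {d⁻¹·a·b⁻¹·d : d ∈ D}, there exists c ∈ D such that c·h·c⁻¹·b ≤ a fails. Then M has no F-inverse cover via Abelian groups: there do not exist a group H and a dual premorphism ψ : H → M with property (1) such that any two elements of the set {k ∈ H : ψ(k) is idempotent} commute. -/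
open FInv

namespace FInv

/-- There is a dual premorphism `ψ : H → M` with property (1) whose "kernel"
`{k : H | ψ k is idempotent}` is commutative. -/
def AbelianKernelCover (M : Type*) [Monoid M] (invM : M → M)
    (H : Type*) [Group H] : Prop :=
  ∃ ψ : H → M, IsDualPremorphism invM ψ ∧ Property1 ψ ∧
    ∀ k₁ k₂ : H, ψ k₁ * ψ k₁ = ψ k₁ → ψ k₂ * ψ k₂ = ψ k₂ → k₁ * k₂ = k₂ * k₁

end FInv

namespace FInv

section aux
variable {M : Type*} [Monoid M] {inv : M → M}

theorem idem_mul_idem (hM : IsInverseMonoid inv) {e f : M} (he : e * e = e) (hf : f * f = f) :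
    (e * f) * (e * f) = e * f ∧ inv (e * f) = e * f := by
  obtain ⟨h1, h2, h3⟩ := hM
  have self : ∀ g : M, g * g = g → g = inv g := fun g hg =>
    h3 g g (by rw [hg, hg]) (by rw [hg, hg])
  have p := h1 (e * f)
  have q := h2 (e * f)
  set x := inv (e * f) with hx
  have hy : f * x * e = x := by
    apply h3 (e * f)
    · calc e * f * (f * x * e) * (e * f) = e * (f * f) * x * ((e * e) * f) := by
            simp only [mul_assoc]
        _ = e * f * x * (e * f) := by rw [he, hf]
        _ = e * f := p
    · calc f * x * e * (e * f) * (f * x * e) = f * (x * ((e * e) * (f * f)) * x) * e := by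
            simp only [mul_assoc]
        _ = f * x * e := by rw [he, hf, q]
  have hxx : x * x = x := by
    calc x * x = (f * x * e) * (f * x * e) := by rw [hy]
      _ = f * (x * (e * f) * x) * e := by simp only [mul_assoc]
      _ = x := by rw [q, hy]
  have h4 : e * f = inv x := h3 x (e * f) q p
  have h5 : e * f = x := by rw [h4, ← self x hxx]
  rw [h5]
  exact ⟨hxx, rfl⟩

theorem idem_comm (hM : IsInverseMonoid inv) {e f : M} (he : e * e = e) (hf : f * f = f) :
    e * f = f * e := by
  obtain ⟨a1, a2⟩ := idem_mul_idem hM he hf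
  obtain ⟨b1, b2⟩ := idem_mul_idem hM hf he
  rw [← a2]
  symm
  apply hM.2.2
  · calc e * f * (f * e) * (e * f) = e * (f * f) * ((e * e) * f) := by simp only [mul_assoc]
      _ = e * f := by rw [he, hf, a1]
  · calc f * e * (e * f) * (f * e) = f * (e * e) * ((f * f) * e) := by simp only [mul_assoc]
      _ = f * e := by rw [he, hf, b1]

theorem mul_inv_idem (hM : IsInverseMonoid inv) (a : M) :
    (a * inv a) * (a * inv a) = a * inv a := by
  rw [← mul_assoc, hM.1]

theorem inv_mul_idem (hM : IsInverseMonoid inv) (a : M) :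
    (inv a * a) * (inv a * a) = inv a * a := by
  rw [← mul_assoc, hM.2.1]

theorem conj_aux (hM : IsInverseMonoid inv) {e : M} (he : e * e = e) (c : M) :
    (c * e * inv c) * c = c * e := by
  calc (c * e * inv c) * c = c * (e * (inv c * c)) := by simp only [mul_assoc]
    _ = (c * inv c * c) * e := by
        rw [idem_comm hM he (inv_mul_idem hM c)]; simp only [mul_assoc]
    _ = c * e := by rw [hM.1]

theorem conj_idem (hM : IsInverseMonoid inv) {e : M} (he : e * e = e) (c : M) :
    (c * e * inv c) * (c * e * inv c) = c * e * inv c := by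
  calc (c * e * inv c) * (c * e * inv c) = ((c * e * inv c) * c) * e * inv c := by
        simp only [mul_assoc]
    _ = c * (e * e) * inv c := by rw [conj_aux hM he]; simp only [mul_assoc]
    _ = _ := by rw [he]

theorem inv_inv' (hM : IsInverseMonoid inv) (a : M) : inv (inv a) = a :=
  (hM.2.2 (inv a) a (hM.2.1 a) (hM.1 a)).symm

theorem natLe_refl (a : M) : natLe a a := ⟨1, one_mul 1, (one_mul a).symm⟩

theorem natLe_trans (hM : IsInverseMonoid inv) {a b c : M} (h1 : natLe a b) (h2 : natLe b c) :
    natLe a c := by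
  obtain ⟨e, he, rfl⟩ := h1
  obtain ⟨f, hf, rfl⟩ := h2
  exact ⟨e * f, (idem_mul_idem hM he hf).1, (mul_assoc _ _ _).symm⟩

theorem natLe_mul_right {a b : M} (h : natLe a b) (c : M) : natLe (a * c) (b * c) := by
  obtain ⟨e, he, rfl⟩ := h
  exact ⟨e, he, mul_assoc _ _ _⟩

theorem natLe_mul_left (hM : IsInverseMonoid inv) {a b : M} (h : natLe a b) (c : M) :
    natLe (c * a) (c * b) := by
  obtain ⟨e, he, rfl⟩ := h
  refine ⟨c * e * inv c, conj_idem hM he c, ?_⟩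
  rw [← mul_assoc, ← mul_assoc, conj_aux hM he]

theorem natLe_mul (hM : IsInverseMonoid inv) {a b c d : M} (h : natLe a b) (h' : natLe c d) :
    natLe (a * c) (b * d) :=
  natLe_trans hM (natLe_mul_right h c) (natLe_mul_left hM h' b)

theorem natLe_inv (hM : IsInverseMonoid inv) {a b : M} (h : natLe a b) :
    natLe (inv a) (inv b) := by
  obtain ⟨e, he, rfl⟩ := h
  have key : inv b * e = inv (e * b) := by
    apply hM.2.2
    · calc e * b * (inv b * e) * (e * b) = e * ((b * inv b) * (e * e)) * b := by
            simp only [mul_assoc]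
        _ = e * e * (b * inv b * b) := by
            rw [he, idem_comm hM (mul_inv_idem hM b) he]; simp only [mul_assoc]; rw [← mul_assoc e e, he]
        _ = e * b := by rw [he, hM.1]
    · calc inv b * e * (e * b) * (inv b * e) = inv b * ((e * e) * (b * inv b)) * e := by
            simp only [mul_assoc]
        _ = (inv b * b * inv b) * (e * e) := by
            rw [he, idem_comm hM he (mul_inv_idem hM b)]; simp only [mul_assoc, he]
        _ = inv b * e := by rw [he, hM.2.1]
  rw [← key]
  have := natLe_mul_left hM (⟨e, he, (mul_one e).symm⟩ : natLe e 1) (inv b)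
  rwa [mul_one] at this

theorem sigma_trans (hM : IsInverseMonoid inv) {a b v : M} (h1 : sigmaRel a v)
    (h2 : sigmaRel b v) : sigmaRel a b := by
  obtain ⟨x, hxa, e, he, rfl⟩ := h1
  obtain ⟨y, hyb, f, hf, rfl⟩ := h2
  refine ⟨e * (f * v), natLe_trans hM ⟨f, hf, ?_⟩ hxa, natLe_trans hM ⟨e, he, rfl⟩ hyb⟩
  rw [← mul_assoc, ← mul_assoc, idem_comm hM he hf]

theorem ker_of_sigma (hM : IsInverseMonoid inv) (hEU : EUnitary M) {H : Type*} [Group H]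
    {ψ : H → M} (hψ : IsDualPremorphism inv ψ) {g k : H} (h : sigmaRel (ψ g) (ψ k)) :
    ψ (g * k⁻¹) * ψ (g * k⁻¹) = ψ (g * k⁻¹) := by
  obtain ⟨z, h1, h2⟩ := h
  refine hEU (z * inv z) _ (mul_inv_idem hM z) ?_
  refine natLe_trans hM (natLe_mul hM h1 (natLe_inv hM h2)) ?_
  rw [← hψ.2.1]
  exact hψ.2.2 _ _

end aux

end FInv

/-- If a finite-above E-unitary inverse monoid satisfies condition (C) for some
maximal σ-related `a, b` and some `v`, then it has no F-inverse cover via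
Abelian groups. -/
theorem stmt13 {M : Type u} [Monoid M] (inv : M → M)
    (hM : IsInverseMonoid inv) (hfa : FiniteAbove M) (hEU : EUnitary M)
    (a b : M) (ha : IsMaximal a) (hb : IsMaximal b) (hab : sigmaRel a b)
    (v : M) (h : M)
    (hub : ∀ d : M, sigmaRel d v → IsMaximal d → natLe (inv d * a * inv b * d) h)
    (hlub : ∀ h' : M,
      (∀ d : M, sigmaRel d v → IsMaximal d → natLe (inv d * a * inv b * d) h') →
      natLe h h')
    (hC : ∃ c : M, sigmaRel c v ∧ IsMaximal c ∧ ¬ natLe (c * h * inv c * b) a) :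
    ¬ ∃ (H : Type u) (instH : Group H), @AbelianKernelCover M _ inv H instH := by
  rintro ⟨H, instH, ψ, hψ, hP, hcomm⟩
  obtain ⟨c, hcv, hc, hnot⟩ := hC
  have lift : ∀ m : M, IsMaximal m → ∃ g : H, ψ g = m := fun m hm => by
    obtain ⟨g, hg⟩ := hP m
    exact ⟨g, hm _ hg⟩
  obtain ⟨α, rfl⟩ := lift a ha
  obtain ⟨β, rfl⟩ := lift b hb
  obtain ⟨γ, rfl⟩ := lift c hc
  have hk := ker_of_sigma hM hEU hψ hab
  have hmul := hψ.2.2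
  have hle : natLe h (ψ (γ⁻¹ * (α * β⁻¹) * γ)) := by
    apply hlub
    intro d hdv hd
    obtain ⟨δ, rfl⟩ := lift d hd
    have hn := ker_of_sigma hM hEU hψ (sigma_trans hM hdv hcv)
    have e1 := hcomm _ _ hk hn
    have e2 : γ⁻¹ * (α * β⁻¹) * γ = δ⁻¹ * α * β⁻¹ * δ := by
      calc γ⁻¹ * (α * β⁻¹) * γ = δ⁻¹ * ((δ * γ⁻¹) * (α * β⁻¹)) * γ := by group
        _ = δ⁻¹ * α * β⁻¹ * δ := by rw [← e1]; group
    rw [e2, ← hψ.2.1, ← hψ.2.1]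
    exact natLe_trans hM (natLe_mul_right (natLe_trans hM (natLe_mul_right (hmul _ _) _)
      (hmul _ _)) _) (hmul _ _)
  apply hnot
  have e3 : α = γ * (γ⁻¹ * (α * β⁻¹) * γ) * γ⁻¹ * β := by group
  have := natLe_mul_right (natLe_mul_right (natLe_mul_left hM hle (ψ γ)) (inv (ψ γ))) (ψ β)
  refine natLe_trans hM this ?_
  rw [← hψ.2.1]
  have h6 := natLe_trans hM (natLe_mul_right (natLe_trans hM (natLe_mul_right
    (hmul γ (γ⁻¹ * (α * β⁻¹) * γ)) (ψ γ⁻¹)) (hmul _ _)) (ψ β)) (hmul _ _)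
  rwa [← e3] at h6
end
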